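/- arXiv:1102.0534 — 2 statements merged into one kernel-verified Lean document; each statement's English description precedes it below -/
import Mathlib

section
/- Let k ≤ n be positive integers and define α(k, n) = (1/k) Σ_{i=1}^k E(X_i), where X_i is the positive square root of a chi-square random variable with n − i + 1 degrees of freedom. Then (1/k) Σ_{i=0}^{k−1} √(n − (i + 1/2)) ≤ α(k, n) ≤ (1/k) Σ_{i=0}^{k−1} √(n − i). -/
open MeasureTheory ProbabilityTheory

/-- The expectation of the positive square root of a chi-square random variable with `p`
degrees of freedom; chi-square with `p` degrees of freedom is the Gamma distribution with
shape `p/2` and rate `1/2`. -/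
noncomputable def chiSqrtMoment (p : ℝ) : ℝ :=
  ∫ x, Real.sqrt x ∂(gammaMeasure (p / 2) (1 / 2))

/-- The constant `α(k, n) = (1/k) Σ_{i=1}^k E(X_i)` where `X_i²` is chi-square with
`n - i + 1` degrees of freedom. -/
noncomputable def alphaConst (k n : ℕ) : ℝ :=
  (1 / (k : ℝ)) * ∑ i ∈ Finset.Icc 1 k, chiSqrtMoment ((n : ℝ) - (i : ℝ) + 1)

/-- Consequence of the log-convexity of the Gamma function at the midpoint of `s` and `s + 1`. -/
theorem sq_Gamma_add_half_le {s : ℝ} (hs : 0 < s) :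
    Real.Gamma (s + 1 / 2) ^ 2 ≤ s * Real.Gamma s ^ 2 := by
  have hG := Real.Gamma_pos_of_pos hs
  have hG₁ := Real.Gamma_pos_of_pos (add_pos hs one_pos)
  have h := Real.Gamma_mul_add_mul_le_rpow_Gamma_mul_rpow_Gamma hs (add_pos hs one_pos)
    one_half_pos one_half_pos (add_halves 1)
  rw [show (1 / 2 : ℝ) * s + 1 / 2 * (s + 1) = s + 1 / 2 by ring,
    ← Real.sqrt_eq_rpow, ← Real.sqrt_eq_rpow, ← Real.sqrt_mul hG.le] at h
  calc Real.Gamma (s + 1 / 2) ^ 2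
      ≤ √(Real.Gamma s * Real.Gamma (s + 1)) ^ 2 :=
        pow_le_pow_left₀ (Real.Gamma_pos_of_pos (by positivity)).le h 2
    _ = Real.Gamma s * Real.Gamma (s + 1) := Real.sq_sqrt (by positivity)
    _ = s * Real.Gamma s ^ 2 := by rw [Real.Gamma_add_one hs.ne']; ring

/-- The ratio `Γ(s + 1/2) / Γ(s)`. -/
noncomputable def gammaHalfRatio (s : ℝ) : ℝ := Real.Gamma (s + 1 / 2) / Real.Gamma s

theorem gammaHalfRatio_pos {s : ℝ} (hs : 0 < s) : 0 < gammaHalfRatio s :=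
  div_pos (Real.Gamma_pos_of_pos (by positivity)) (Real.Gamma_pos_of_pos hs)

theorem sq_gammaHalfRatio_le {s : ℝ} (hs : 0 < s) : gammaHalfRatio s ^ 2 ≤ s := by
  rw [gammaHalfRatio, div_pow, div_le_iff₀ (pow_pos (Real.Gamma_pos_of_pos hs) 2)]
  exact sq_Gamma_add_half_le hs

theorem sub_half_le_sq_gammaHalfRatio {s : ℝ} (hs : 1 / 2 < s) :
    s - 1 / 2 ≤ gammaHalfRatio s ^ 2 := by
  have hs₀ : 0 < s := one_half_pos.trans hs
  have hs₁ : 0 < s - 1 / 2 := sub_pos.2 hs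
  have h := sq_Gamma_add_half_le hs₁
  have hrec := Real.Gamma_add_one hs₁.ne'
  rw [sub_add_cancel] at h
  rw [show s - 1 / 2 + 1 = s + 1 / 2 by ring] at hrec
  rw [gammaHalfRatio, div_pow, le_div_iff₀ (pow_pos (Real.Gamma_pos_of_pos hs₀) 2), hrec]
  nlinarith

theorem gammaHalfRatio_add_one {s : ℝ} (hs : 0 < s) :
    gammaHalfRatio (s + 1) = gammaHalfRatio s * ((s + 1 / 2) / s) := by
  have hG := (Real.Gamma_pos_of_pos hs).ne'
  rw [gammaHalfRatio, gammaHalfRatio, show s + 1 + 1 / 2 = s + 1 / 2 + 1 by ring,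
    Real.Gamma_add_one (by positivity), Real.Gamma_add_one hs.ne']
  field_simp

theorem sq_gammaHalfRatio_add_one_div_le {s : ℝ} (hs : 1 / 4 < s) :
    gammaHalfRatio (s + 1) ^ 2 / (s + 1 - 1 / 4) ≤ gammaHalfRatio s ^ 2 / (s - 1 / 4) := by
  have hs₀ : 0 < s := lt_trans (by norm_num) hs
  have hs₁ : 0 < s - 1 / 4 := sub_pos.2 hs
  have hs₂ : 0 < s + 1 - 1 / 4 := by linarith
  rw [gammaHalfRatio_add_one hs₀, mul_pow, mul_div_assoc, div_eq_mul_inv _ (s - 1 / 4)]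
  refine mul_le_mul_of_nonneg_left ?_ (sq_nonneg _)
  rw [div_pow, div_div, inv_eq_one_div, div_le_div_iff₀ (by positivity) hs₁]
  nlinarith

theorem sq_gammaHalfRatio_add_nat_div_le {s : ℝ} (hs : 1 / 4 < s) (m : ℕ) :
    gammaHalfRatio (s + m) ^ 2 / (s + m - 1 / 4) ≤ gammaHalfRatio s ^ 2 / (s - 1 / 4) := by
  induction m with
  | zero => simp
  | succ m ih =>
    have hm : 1 / 4 < s + m := hs.trans_le (le_add_of_nonneg_right m.cast_nonneg)
    rw [Nat.cast_add_one, ← add_assoc]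
    exact (sq_gammaHalfRatio_add_one_div_le hm).trans ih

/-- Watson's inequality `s - 1/4 ≤ (Γ(s + 1/2) / Γ(s))²`. -/
theorem sub_quarter_le_sq_gammaHalfRatio {s : ℝ} (hs : 1 / 4 < s) :
    s - 1 / 4 ≤ gammaHalfRatio s ^ 2 := by
  have hs₁ : 0 < s - 1 / 4 := sub_pos.2 hs
  rw [← one_le_div hs₁]
  by_contra! hc
  set c := gammaHalfRatio s ^ 2 / (s - 1 / 4)
  obtain ⟨m, hm⟩ := exists_nat_gt (1 + 1 / (4 * (1 - c)))
  have hc' : 0 < 1 - c := sub_pos.2 hc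
  have hm₁ : 1 < (m : ℝ) := lt_trans (lt_add_of_pos_right 1 (by positivity)) hm
  have hpos : 0 < s + m - 1 / 4 := by linarith
  have h := sq_gammaHalfRatio_add_nat_div_le hs m
  rw [div_le_iff₀ hpos] at h
  have hlow := sub_half_le_sq_gammaHalfRatio (s := s + m) (by linarith)
  have hlarge : 1 / (4 * (1 - c)) < s + m - 1 / 4 := by linarith
  rw [div_lt_iff₀ (by positivity)] at hlarge
  linarith

theorem chiSqrtMoment_eq {p : ℝ} (hp : 0 < p) :
    chiSqrtMoment p = √2 * gammaHalfRatio (p / 2) := by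
  have hpos : ∀ x ∈ Set.Ioi (0 : ℝ), (gammaPDF (p / 2) (1 / 2) x).toReal • √x =
      (1 / 2) ^ (p / 2) / Real.Gamma (p / 2) *
        (x ^ (p / 2 + 1 / 2 - 1) * Real.exp (-(1 / 2 * x))) := by
    intro x (hx : 0 < x)
    rw [gammaPDF, ENNReal.toReal_ofReal (gammaPDFReal_nonneg (by positivity) one_half_pos x),
      gammaPDFReal, if_pos hx.le, smul_eq_mul, Real.sqrt_eq_rpow,
      show p / 2 + 1 / 2 - 1 = p / 2 - 1 + 1 / 2 by ring, Real.rpow_add hx]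
    ring
  have hzero : ∀ x ∉ Set.Ioi (0 : ℝ), (gammaPDF (p / 2) (1 / 2) x).toReal • √x = 0 := by
    intro x hx
    rw [Real.sqrt_eq_zero_of_nonpos (not_lt.1 hx), smul_zero]
  have hmeas : Measurable (gammaPDF (p / 2) (1 / 2)) :=
    (measurable_gammaPDFReal _ _).ennreal_ofReal
  rw [chiSqrtMoment, gammaMeasure, integral_withDensity_eq_integral_toReal_smul hmeas
    (ae_of_all _ fun _ ↦ ENNReal.ofReal_lt_top), ← setIntegral_eq_integral_of_forall_compl_eq_zero
    hzero, setIntegral_congr_fun measurableSet_Ioi hpos, integral_const_mul,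
    Real.integral_rpow_mul_exp_neg_mul_Ioi (by positivity) one_half_pos, gammaHalfRatio,
    show (1 : ℝ) / (1 / 2) = 2 by norm_num, Real.rpow_add two_pos, ← Real.sqrt_eq_rpow,
    one_div, Real.inv_rpow zero_le_two]
  field_simp

theorem chiSqrtMoment_le_sqrt {p : ℝ} (hp : 0 < p) : chiSqrtMoment p ≤ √p := by
  apply Real.le_sqrt_of_sq_le
  rw [chiSqrtMoment_eq hp, mul_pow, Real.sq_sqrt zero_le_two]
  linarith [sq_gammaHalfRatio_le (half_pos hp)]

theorem sqrt_sub_half_le_chiSqrtMoment {p : ℝ} (hp : 1 / 2 < p) :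
    √(p - 1 / 2) ≤ chiSqrtMoment p := by
  have hp₀ : 0 < p := one_half_pos.trans hp
  rw [chiSqrtMoment_eq hp₀]
  refine Real.sqrt_le_iff.2
    ⟨mul_nonneg (Real.sqrt_nonneg 2) (gammaHalfRatio_pos (half_pos hp₀)).le, ?_⟩
  rw [mul_pow, Real.sq_sqrt zero_le_two]
  linarith [sub_quarter_le_sq_gammaHalfRatio (s := p / 2) (by linarith)]

theorem alphaConst_eq_sum_range (k n : ℕ) :
    alphaConst k n = (1 / (k : ℝ)) * ∑ i ∈ Finset.range k, chiSqrtMoment ((n : ℝ) - i) := by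
  rw [alphaConst, ← Finset.Ico_add_one_right_eq_Icc, Finset.sum_Ico_eq_sum_range,
    Nat.add_sub_cancel]
  congr! 3 with i
  push_cast
  ring

/-- **Estimates for the constant.**  For `1 ≤ k ≤ n`,
`(1/k) Σ_{i=0}^{k−1} √(n − (i + 1/2)) ≤ α(k, n) ≤ (1/k) Σ_{i=0}^{k−1} √(n − i)`. -/
theorem alphaConst_estimates (k n : ℕ) (hk : 0 < k) (hkn : k ≤ n) :
    (1 / (k : ℝ)) * ∑ i ∈ Finset.range k, Real.sqrt ((n : ℝ) - ((i : ℝ) + 1 / 2))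
        ≤ alphaConst k n
      ∧ alphaConst k n
        ≤ (1 / (k : ℝ)) * ∑ i ∈ Finset.range k, Real.sqrt ((n : ℝ) - (i : ℝ)) := by
  rw [alphaConst_eq_sum_range]
  have hone : ∀ i ∈ Finset.range k, (1 : ℝ) ≤ n - i := by
    intro i hi
    have : ((i + 1 : ℕ) : ℝ) ≤ n := Nat.cast_le.2 ((Finset.mem_range.1 hi).trans_le hkn)
    push_cast at this
    linarith
  constructor
  · refine mul_le_mul_of_nonneg_left (Finset.sum_le_sum fun i hi ↦ ?_) (by positivity)
    rw [← sub_sub]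
    exact sqrt_sub_half_le_chiSqrtMoment (by linarith [hone i hi])
  · refine mul_le_mul_of_nonneg_left (Finset.sum_le_sum fun i hi ↦ ?_) (by positivity)
    exact chiSqrtMoment_le_sqrt (by linarith [hone i hi])
end

section
/- Let k ≤ n be positive integers and define α(k, n) = (1/k) Σ_{i=1}^k E(X_i), where X_i is the positive square root of a chi-square random variable with n − i + 1 degrees of freedom. Then (2/(3k))·[n^{3/2} − (n − k)^{3/2}] ≤ α(k, n) ≤ (2/(3k))·[n^{3/2} − (n − k)^{3/2}] + (1/(2k))·[√n − √(n − k)]. -/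
open MeasureTheory ProbabilityTheory

theorem integral_sqrt_gammaMeasure {a r : ℝ} (ha : 0 < a) (hr : 0 < r) :
    ∫ x, √x ∂(gammaMeasure a r) =
      r ^ a / Real.Gamma a * ((1 / r) ^ (a + 1 / 2) * Real.Gamma (a + 1 / 2)) := by
  unfold gammaMeasure gammaPDF
  rw [integral_withDensity_eq_integral_toReal_smul
    (measurable_gammaPDFReal a r).ennreal_ofReal (ae_of_all _ fun _ ↦ ENNReal.ofReal_lt_top),
    ← Real.integral_rpow_mul_exp_neg_mul_Ioi (by positivity : 0 < a + 1 / 2) hr,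
    ← integral_const_mul, ← integral_indicator measurableSet_Ioi]
  refine integral_congr_ae (ae_of_all _ fun x ↦ ?_)
  rcases le_or_gt x 0 with hx | hx
  · simp [Real.sqrt_eq_zero_of_nonpos hx, hx]
  · have hpow : x ^ (a + 1 / 2 - 1) = x ^ (a - 1) * x ^ (1 / 2 : ℝ) := by
      rw [← Real.rpow_add hx]
      ring_nf
    simp only [ENNReal.toReal_ofReal (gammaPDFReal_nonneg ha hr x)]
    simp only [gammaPDFReal, if_pos hx.le, smul_eq_mul,
      Set.indicator_of_mem (Set.mem_Ioi.mpr hx), hpow, Real.sqrt_eq_rpow]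
    ring

theorem chiSqrtMoment_eq_Gamma_div_Gamma {p : ℝ} (hp : 0 < p) :
    chiSqrtMoment p = √2 * Real.Gamma ((p + 1) / 2) / Real.Gamma (p / 2) := by
  have h : (1 / 2 : ℝ) ^ (p / 2) * (1 / (1 / 2) : ℝ) ^ (p / 2 + 1 / 2) = √2 := by
    rw [one_div_one_div, Real.rpow_add two_pos, ← mul_assoc,
      ← Real.mul_rpow (by norm_num) (by norm_num), Real.sqrt_eq_rpow]
    norm_num
  rw [chiSqrtMoment, integral_sqrt_gammaMeasure (half_pos hp) (by norm_num), ← h, add_div]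
  ring

theorem chiSqrtMoment_pos {p : ℝ} (hp : 0 < p) : 0 < chiSqrtMoment p := by
  rw [chiSqrtMoment_eq_Gamma_div_Gamma hp]
  have := Real.Gamma_pos_of_pos (half_pos hp)
  have := Real.Gamma_pos_of_pos (by positivity : 0 < (p + 1) / 2)
  positivity

theorem chiSqrtMoment_mul_chiSqrtMoment_add_one {p : ℝ} (hp : 0 < p) :
    chiSqrtMoment p * chiSqrtMoment (p + 1) = p := by
  have h₀ := (Real.Gamma_pos_of_pos (half_pos hp)).ne'
  have h₁ := (Real.Gamma_pos_of_pos (by positivity : 0 < (p + 1) / 2)).ne'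
  rw [chiSqrtMoment_eq_Gamma_div_Gamma hp, chiSqrtMoment_eq_Gamma_div_Gamma (by positivity),
    show (p + 1 + 1) / 2 = p / 2 + 1 by ring, Real.Gamma_add_one (by positivity)]
  field_simp
  norm_num

theorem chiSqrtMoment_sq_le {p : ℝ} (hp : 0 < p) : chiSqrtMoment p ^ 2 ≤ p := by
  have h₀ := Real.Gamma_pos_of_pos (half_pos hp)
  have h₁ := Real.Gamma_pos_of_pos (by positivity : 0 < (p + 1) / 2)
  have h := Real.Gamma_mul_add_mul_le_rpow_Gamma_mul_rpow_Gamma (half_pos hp)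
    (by positivity : 0 < p / 2 + 1) one_half_pos one_half_pos (by norm_num)
  rw [show 1 / 2 * (p / 2) + 1 / 2 * (p / 2 + 1) = (p + 1) / 2 by ring,
    Real.Gamma_add_one (by positivity), ← Real.mul_rpow h₀.le (by positivity),
    ← Real.sqrt_eq_rpow, Real.le_sqrt h₁.le (by positivity)] at h
  rw [chiSqrtMoment_eq_Gamma_div_Gamma hp, div_pow, mul_pow, Real.sq_sqrt zero_le_two,
    div_le_iff₀ (by positivity)]
  linarith

theorem le_chiSqrtMoment_add_one_sq {p : ℝ} (hp : 0 < p) : p ≤ chiSqrtMoment (p + 1) ^ 2 := by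
  have h : chiSqrtMoment p ^ 2 * chiSqrtMoment (p + 1) ^ 2 = p * p := by
    rw [← mul_pow, chiSqrtMoment_mul_chiSqrtMoment_add_one hp, sq]
  have := mul_le_mul_of_nonneg_right (chiSqrtMoment_sq_le hp) (sq_nonneg (chiSqrtMoment (p + 1)))
  exact le_of_mul_le_mul_left (h ▸ this) hp

theorem chiSqrtMoment_add_two {p : ℝ} (hp : 0 < p) :
    chiSqrtMoment (p + 2) * p = chiSqrtMoment p * (p + 1) := by
  have h₀ := chiSqrtMoment_mul_chiSqrtMoment_add_one hp
  have h₁ := chiSqrtMoment_mul_chiSqrtMoment_add_one (by positivity : 0 < p + 1)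
  rw [add_assoc, one_add_one_eq_two] at h₁
  linear_combination (-chiSqrtMoment (p + 2)) * h₀ + chiSqrtMoment p * h₁

theorem chiSqrtMoment_add_two_sq_mul_le {p : ℝ} (hp : 0 < p) :
    chiSqrtMoment (p + 2) ^ 2 * (p - 1 / 2) ≤ chiSqrtMoment p ^ 2 * (p + 2 - 1 / 2) := by
  refine le_of_mul_le_mul_right ?_ (sq_pos_of_pos hp)
  calc chiSqrtMoment (p + 2) ^ 2 * (p - 1 / 2) * p ^ 2
      = (chiSqrtMoment (p + 2) * p) ^ 2 * (p - 1 / 2) := by ring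
    _ = chiSqrtMoment p ^ 2 * ((p + 1) ^ 2 * (p - 1 / 2)) := by
      rw [chiSqrtMoment_add_two hp]
      ring
    _ ≤ chiSqrtMoment p ^ 2 * ((p + 2 - 1 / 2) * p ^ 2) := by
      refine mul_le_mul_of_nonneg_left ?_ (sq_nonneg _)
      linarith
    _ = chiSqrtMoment p ^ 2 * (p + 2 - 1 / 2) * p ^ 2 := by ring

theorem chiSqrtMoment_add_two_mul_sq_mul_le {p : ℝ} (hp : 1 / 2 < p) (j : ℕ) :
    chiSqrtMoment (p + 2 * j) ^ 2 * (p - 1 / 2) ≤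
      chiSqrtMoment p ^ 2 * (p + 2 * j - 1 / 2) := by
  induction j with
  | zero => simp
  | succ j ih =>
    have hj : (0 : ℝ) ≤ j := j.cast_nonneg
    have h := chiSqrtMoment_add_two_sq_mul_le (by linarith : 0 < p + 2 * j)
    rw [show p + 2 * (j + 1 : ℕ) = p + 2 * j + 2 by push_cast; ring]
    refine le_of_mul_le_mul_right ?_ (by linarith : 0 < p + 2 * j - 1 / 2)
    calc _ = chiSqrtMoment (p + 2 * j + 2) ^ 2 * (p + 2 * j - 1 / 2) * (p - 1 / 2) := by ring
      _ ≤ chiSqrtMoment (p + 2 * j) ^ 2 * (p + 2 * j + 2 - 1 / 2) * (p - 1 / 2) :=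
        mul_le_mul_of_nonneg_right h (by linarith)
      _ = chiSqrtMoment (p + 2 * j) ^ 2 * (p - 1 / 2) * (p + 2 * j + 2 - 1 / 2) := by ring
      _ ≤ chiSqrtMoment p ^ 2 * (p + 2 * j - 1 / 2) * (p + 2 * j + 2 - 1 / 2) :=
        mul_le_mul_of_nonneg_right ih (by linarith)
      _ = _ := by ring

theorem sub_half_le_chiSqrtMoment_sq {p : ℝ} (hp : 1 / 2 < p) :
    p - 1 / 2 ≤ chiSqrtMoment p ^ 2 := by
  by_contra! hlt
  set d := p - 1 / 2 - chiSqrtMoment p ^ 2 with hd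
  have hd_pos : 0 < d := by linarith
  obtain ⟨j, hj⟩ := exists_nat_gt (p / d)
  rw [div_lt_iff₀ hd_pos] at hj
  have hj_one : (1 : ℝ) ≤ j := by
    rcases Nat.eq_zero_or_pos j with rfl | h
    · norm_num at hj
      linarith
    · exact_mod_cast h
  have h₁ := chiSqrtMoment_add_two_mul_sq_mul_le hp j
  have h₂ := le_chiSqrtMoment_add_one_sq (by linarith : 0 < p + 2 * j - 1)
  rw [sub_add_cancel] at h₂
  have h₃ := mul_le_mul_of_nonneg_right h₂ (by linarith : 0 ≤ p - 1 / 2)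
  have h₄ : 0 < d * (p - 1 / 2) := mul_pos hd_pos (by linarith)
  rw [show chiSqrtMoment p ^ 2 = p - 1 / 2 - d by rw [hd]; ring] at h₁
  linarith

theorem rpow_three_halves {x : ℝ} (hx : 0 ≤ x) : x ^ (3 / 2 : ℝ) = √x ^ 3 := by
  rw [Real.sqrt_eq_rpow, ← Real.rpow_natCast, ← Real.rpow_mul hx]
  norm_num

theorem sub_rpow_three_halves_le_chiSqrtMoment {p : ℝ} (hp : 1 ≤ p) :
    2 / 3 * (p ^ (3 / 2 : ℝ) - (p - 1) ^ (3 / 2 : ℝ)) ≤ chiSqrtMoment p := by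
  rw [rpow_three_halves (by linarith), rpow_three_halves (by linarith)]
  have hm := sub_half_le_chiSqrtMoment_sq (by linarith : 1 / 2 < p)
  have hm_pos := chiSqrtMoment_pos (by linarith : 0 < p)
  have ha : 0 < √p := Real.sqrt_pos.mpr (by linarith)
  have hb : 0 ≤ √(p - 1) := Real.sqrt_nonneg _
  have ha_sq := Real.sq_sqrt (by linarith : 0 ≤ p)
  have hb_sq := Real.sq_sqrt (by linarith : 0 ≤ p - 1)
  set a := √p
  set b := √(p - 1)
  set m := chiSqrtMoment p
  have hab : (a - b) * (a + b) = 1 := by linear_combination ha_sq - hb_sq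
  have key : 2 * (a ^ 2 + a * b + b ^ 2) ≤ 3 * (a + b) * m := by
    refine le_of_sq_le_sq ?_ (by positivity)
    have h₁ : (a ^ 2 + b ^ 2) / 2 ≤ m ^ 2 := by linarith
    have h₂ : 0 ≤ (a - b) ^ 2 * (a ^ 2 + b ^ 2 + 4 * (a * b)) := by positivity
    have h₃ := mul_le_mul_of_nonneg_left h₁ (by positivity : 0 ≤ 9 * (a + b) ^ 2)
    linarith
  refine le_of_mul_le_mul_right ?_ (by positivity : 0 < 3 * (a + b))
  calc _ = 2 * (a ^ 2 + a * b + b ^ 2) * ((a - b) * (a + b)) := by ring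
    _ ≤ _ := by
      rw [hab]
      linarith

theorem chiSqrtMoment_le_sub_rpow_three_halves_add {p : ℝ} (hp : 1 ≤ p) :
    chiSqrtMoment p ≤
      2 / 3 * (p ^ (3 / 2 : ℝ) - (p - 1) ^ (3 / 2 : ℝ)) + 1 / 2 * (√p - √(p - 1)) := by
  rw [rpow_three_halves (by linarith), rpow_three_halves (by linarith)]
  have hm : chiSqrtMoment p ≤ √p := Real.le_sqrt_of_sq_le (chiSqrtMoment_sq_le (by linarith))
  have ha : 0 < √p := Real.sqrt_pos.mpr (by linarith)
  have hb : 0 ≤ √(p - 1) := Real.sqrt_nonneg _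
  have ha_sq := Real.sq_sqrt (by linarith : 0 ≤ p)
  have hb_sq := Real.sq_sqrt (by linarith : 0 ≤ p - 1)
  refine hm.trans ?_
  set a := √p
  set b := √(p - 1)
  have hab : (a - b) * (a + b) = 1 := by linear_combination ha_sq - hb_sq
  refine le_of_mul_le_mul_right ?_ (by positivity : 0 < a + b)
  calc a * (a + b) ≤ 2 / 3 * (a ^ 2 + a * b + b ^ 2) + 1 / 2 * (a ^ 2 - b ^ 2) := by
        linarith [sq_nonneg (a - b)]
    _ = 2 / 3 * (a ^ 2 + a * b + b ^ 2) * ((a - b) * (a + b)) + 1 / 2 * (a ^ 2 - b ^ 2) := by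
        rw [hab, mul_one]
    _ = _ := by ring

theorem sum_Icc_cast_sub (F : ℝ → ℝ) (x : ℝ) (k : ℕ) :
    ∑ i ∈ Finset.Icc 1 k, (F (x - i + 1) - F (x - i + 1 - 1)) = F x - F (x - k) := by
  induction k with
  | zero => simp
  | succ k ih =>
    rw [Finset.sum_Icc_succ_top (by lia), ih]
    push_cast
    ring_nf

/-- **Simplified estimates.**  For `1 ≤ k ≤ n`,
`(2/(3k))·[n^{3/2} − (n−k)^{3/2}] ≤ α(k, n)
  ≤ (2/(3k))·[n^{3/2} − (n−k)^{3/2}] + (1/(2k))·[√n − √(n−k)]`. -/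
theorem alphaConst_simplified_estimates (k n : ℕ) (hk : 0 < k) (hkn : k ≤ n) :
    (2 / (3 * (k : ℝ))) * ((n : ℝ) ^ ((3 : ℝ) / 2) - ((n : ℝ) - (k : ℝ)) ^ ((3 : ℝ) / 2))
        ≤ alphaConst k n
      ∧ alphaConst k n
        ≤ (2 / (3 * (k : ℝ))) * ((n : ℝ) ^ ((3 : ℝ) / 2) - ((n : ℝ) - (k : ℝ)) ^ ((3 : ℝ) / 2))
          + (1 / (2 * (k : ℝ))) * (Real.sqrt (n : ℝ) - Real.sqrt ((n : ℝ) - (k : ℝ))) := by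
  have hk_pos : (0 : ℝ) < k := by exact_mod_cast hk
  have hp : ∀ i ∈ Finset.Icc 1 k, (1 : ℝ) ≤ n - i + 1 := fun i hi ↦ by
    have : (i : ℝ) ≤ n := by exact_mod_cast (Finset.mem_Icc.mp hi).2.trans hkn
    linarith
  have lower := Finset.sum_le_sum fun i hi ↦ sub_rpow_three_halves_le_chiSqrtMoment (hp i hi)
  have upper := Finset.sum_le_sum fun i hi ↦ chiSqrtMoment_le_sub_rpow_three_halves_add (hp i hi)
  rw [← Finset.mul_sum, sum_Icc_cast_sub (· ^ (3 / 2 : ℝ))] at lower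
  rw [Finset.sum_add_distrib, ← Finset.mul_sum, ← Finset.mul_sum,
    sum_Icc_cast_sub (· ^ (3 / 2 : ℝ)), sum_Icc_cast_sub Real.sqrt] at upper
  have hk_inv : (0 : ℝ) ≤ 1 / k := by positivity
  constructor
  · refine le_trans (le_of_eq ?_) (mul_le_mul_of_nonneg_left lower hk_inv)
    field_simp
  · refine (mul_le_mul_of_nonneg_left upper hk_inv).trans (le_of_eq ?_)
    field_simp
end
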